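/- Let A = kQ/I be a gentle one-cycle algebra whose unique cycle 𝒞 = a_1⋯a_l is a full-relational oriented cycle, and let 1 ≤ t ≤ l. Then every G-projective right Ā_{𝒞,t}-module is projective (i.e. G-proj(Ā_{𝒞,t}) = proj(Ā_{𝒞,t})), and the restriction of T_{𝒞,t} = − ⊗_A Ā_{𝒞,t} to the category of G-projective right A-modules is a surjection onto the category of projective right Ā_{𝒞,t}-modules: every projective right Ā_{𝒞,t}-module is isomorphic to T_{𝒞,t}(G) for some G-projective right A-module G. -/

import Mathlib

/- Common infrastructure: finite quivers, path algebras, gentle algebras,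
   right modules, Gorenstein projective modules, etc. -/

open MulOpposite

noncomputable section

/-- A finite quiver, with `nV` vertices and `nE` arrows. -/
structure QuiverData where
  nV : ℕ
  nE : ℕ
  src : Fin nE → Fin nV
  tgt : Fin nE → Fin nV

/-- The relations defining the path algebra `kQ` as a quotient of the free
algebra on the set of vertices and arrows:  the trivial paths `e_v` are
orthogonal idempotents summing to `1`, and `e_{s(a)} * a = a = a * e_{t(a)}`.
(Paths are composed left-to-right, matching the paper's convention.) -/
inductive PathRel (k : Type) [Field k] (Q : QuiverData) :
    FreeAlgebra k (Fin Q.nV ⊕ Fin Q.nE) → FreeAlgebra k (Fin Q.nV ⊕ Fin Q.nE) → Prop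
  | vtx_mul (v w : Fin Q.nV) : PathRel k Q
      (FreeAlgebra.ι k (Sum.inl v) * FreeAlgebra.ι k (Sum.inl w))
      (if v = w then FreeAlgebra.ι k (Sum.inl v) else 0)
  | vtx_sum : PathRel k Q (∑ v : Fin Q.nV, FreeAlgebra.ι k (Sum.inl v)) 1
  | src_arr (e : Fin Q.nE) : PathRel k Q
      (FreeAlgebra.ι k (Sum.inl (Q.src e)) * FreeAlgebra.ι k (Sum.inr e))
      (FreeAlgebra.ι k (Sum.inr e))
  | arr_tgt (e : Fin Q.nE) : PathRel k Q
      (FreeAlgebra.ι k (Sum.inr e) * FreeAlgebra.ι k (Sum.inl (Q.tgt e)))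
      (FreeAlgebra.ι k (Sum.inr e))

/-- The path algebra `kQ`. -/
def PathAlg (k : Type) [Field k] (Q : QuiverData) := RingQuot (PathRel k Q)

instance (k : Type) [Field k] (Q : QuiverData) : Ring (PathAlg k Q) :=
  inferInstanceAs (Ring (RingQuot (PathRel k Q)))

instance (k : Type) [Field k] (Q : QuiverData) : Algebra k (PathAlg k Q) :=
  inferInstanceAs (Algebra k (RingQuot (PathRel k Q)))

/-- The arrow `e`, as an element of the path algebra. -/
def arr (k : Type) [Field k] (Q : QuiverData) (e : Fin Q.nE) : PathAlg k Q :=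
  RingQuot.mkAlgHom k (PathRel k Q) (FreeAlgebra.ι k (Sum.inr e))

/-- The trivial path (idempotent) at the vertex `v`, in the path algebra. -/
def vtx (k : Type) [Field k] (Q : QuiverData) (v : Fin Q.nV) : PathAlg k Q :=
  RingQuot.mkAlgHom k (PathRel k Q) (FreeAlgebra.ι k (Sum.inl v))

/-- Given a set `Rel` of (composable) pairs of arrows, the relation on `kQ`
identifying each corresponding length-two path with `0`; the quotient is
`kQ/I` where `I` is the two-sided ideal generated by these paths of length two. -/
def GRel (k : Type) [Field k] (Q : QuiverData) (Rel : Set (Fin Q.nE × Fin Q.nE)) :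
    PathAlg k Q → PathAlg k Q → Prop := fun x y =>
  (∃ p ∈ Rel, x = arr k Q p.1 * arr k Q p.2) ∧ y = 0

/-- The algebra `A = kQ/I`. -/
def GAlg (k : Type) [Field k] (Q : QuiverData) (Rel : Set (Fin Q.nE × Fin Q.nE)) :=
  RingQuot (GRel k Q Rel)

instance (k : Type) [Field k] (Q : QuiverData) (Rel : Set (Fin Q.nE × Fin Q.nE)) :
    Ring (GAlg k Q Rel) := inferInstanceAs (Ring (RingQuot (GRel k Q Rel)))

instance (k : Type) [Field k] (Q : QuiverData) (Rel : Set (Fin Q.nE × Fin Q.nE)) :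
    Algebra k (GAlg k Q Rel) := inferInstanceAs (Algebra k (RingQuot (GRel k Q Rel)))

/-- The canonical projection `kQ → kQ/I`. -/
def gmap (k : Type) [Field k] (Q : QuiverData) (Rel : Set (Fin Q.nE × Fin Q.nE)) :
    PathAlg k Q →ₐ[k] GAlg k Q Rel := RingQuot.mkAlgHom k (GRel k Q Rel)

/-- Membership in the ideal `I` (the kernel of `kQ → kQ/I`). -/
def inI (k : Type) [Field k] (Q : QuiverData) (Rel : Set (Fin Q.nE × Fin Q.nE))
    (x : PathAlg k Q) : Prop := gmap k Q Rel x = 0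

/-- The idempotent `ε_v ∈ A` at a vertex `v`. -/
def vtxA (k : Type) [Field k] (Q : QuiverData) (Rel : Set (Fin Q.nE × Fin Q.nE))
    (v : Fin Q.nV) : GAlg k Q Rel := gmap k Q Rel (vtx k Q v)

/-- The image in `A` of an arrow `e`. -/
def arrA (k : Type) [Field k] (Q : QuiverData) (Rel : Set (Fin Q.nE × Fin Q.nE))
    (e : Fin Q.nE) : GAlg k Q Rel := gmap k Q Rel (arr k Q e)

/-- `(Q, I)` is a gentle pair (with `I` the ideal generated by the length-two
paths coming from `Rel`), and moreover `I` is admissible. -/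
structure IsGentle (k : Type) [Field k] (Q : QuiverData)
    (Rel : Set (Fin Q.nE × Fin Q.nE)) : Prop where
  /-- the generating relations are composable length-two paths -/
  comp_rel : ∀ p ∈ Rel, Q.tgt p.1 = Q.src p.2
  /-- every vertex is the source of at most two arrows -/
  src_card : ∀ v, (Finset.univ.filter fun e => Q.src e = v).card ≤ 2
  /-- every vertex is the target of at most two arrows -/
  tgt_card : ∀ v, (Finset.univ.filter fun e => Q.tgt e = v).card ≤ 2
  /-- for each arrow `a` there is at most one arrow `b` with `ab ∉ I` -/
  uniq_nonrel_right : ∀ a b c, ¬ inI k Q Rel (arr k Q a * arr k Q b) →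
    ¬ inI k Q Rel (arr k Q a * arr k Q c) → b = c
  /-- for each arrow `a` there is at most one arrow `c` with `ca ∉ I` -/
  uniq_nonrel_left : ∀ a b c, ¬ inI k Q Rel (arr k Q b * arr k Q a) →
    ¬ inI k Q Rel (arr k Q c * arr k Q a) → b = c
  /-- for each arrow `a` there is at most one (composable) arrow `b` with `ab ∈ I` -/
  uniq_rel_right : ∀ a b c, Q.tgt a = Q.src b → Q.tgt a = Q.src c →
    inI k Q Rel (arr k Q a * arr k Q b) → inI k Q Rel (arr k Q a * arr k Q c) → b = c
  /-- for each arrow `a` there is at most one (composable) arrow `c` with `ca ∈ I` -/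
  uniq_rel_left : ∀ a b c, Q.tgt b = Q.src a → Q.tgt c = Q.src a →
    inI k Q Rel (arr k Q b * arr k Q a) → inI k Q Rel (arr k Q c * arr k Q a) → b = c
  /-- admissibility: some power of the arrow ideal is contained in `I` -/
  admissible : ∃ m, 2 ≤ m ∧ ∀ f : Fin m → Fin Q.nE,
    inI k Q Rel (List.ofFn fun i => arr k Q (f i)).prod

/-- A full-relational oriented cycle `𝒞 = a_1 ⋯ a_len` (of length ≥ 3, as assumed
throughout the paper) in the bound quiver `(Q, I)`, encoded by a periodic
sequence of arrows.  `arrows i` is the arrow `a_{i+1}` (`0`-indexed),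
consecutive arrows are composable, all consecutive length-two paths lie in `I`,
and the vertices of the cycle are pairwise distinct. -/
structure FRCycle (k : Type) [Field k] (Q : QuiverData)
    (Rel : Set (Fin Q.nE × Fin Q.nE)) where
  len : ℕ
  len3 : 3 ≤ len
  arrows : ℕ → Fin Q.nE
  periodic : ∀ i, arrows (i + len) = arrows i
  comp : ∀ i, Q.tgt (arrows i) = Q.src (arrows (i + 1))
  frel : ∀ i, inI k Q Rel (arr k Q (arrows i) * arr k Q (arrows (i + 1)))
  vinj : ∀ i j, i < len → j < len → Q.src (arrows i) = Q.src (arrows j) → i = j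

/-- There are no full-relational oriented cycles of length `< 3` (the blanket
assumption of the paper). -/
def NoShortFRC (k : Type) [Field k] (Q : QuiverData)
    (Rel : Set (Fin Q.nE × Fin Q.nE)) : Prop :=
  ∀ (l : ℕ) (c : ℕ → Fin Q.nE), 1 ≤ l → (∀ i, c (i + l) = c i) →
    (∀ i, Q.tgt (c i) = Q.src (c (i + 1))) →
    (∀ i, inI k Q Rel (arr k Q (c i) * arr k Q (c (i + 1)))) → 3 ≤ l

/-- The set of arrows lying on the cycle. -/
def FRCycle.arrowSet {k : Type} [Field k] {Q : QuiverData}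
    {Rel : Set (Fin Q.nE × Fin Q.nE)} (C : FRCycle k Q Rel) : Set (Fin Q.nE) :=
  {a | ∃ i < C.len, C.arrows i = a}

/-- The idempotent `ε_{𝒞,t} ∈ A`: the sum of the `ε_v` over the vertices `v`
of the cycle `𝒞` other than `s(a_t)` and `t(a_t)`. -/
def epsCt (k : Type) [Field k] (Q : QuiverData) (Rel : Set (Fin Q.nE × Fin Q.nE))
    (C : FRCycle k Q Rel) (t : ℕ) : GAlg k Q Rel :=
  ∑ i ∈ (Finset.range C.len).filter
      (fun i => Q.src (C.arrows i) ≠ Q.src (C.arrows t) ∧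
        Q.src (C.arrows i) ≠ Q.tgt (C.arrows t)),
    vtxA k Q Rel (Q.src (C.arrows i))

/-- The relation identifying an element `ε` of a ring with `0`; the quotient is
`R/RεR`. -/
def QuotRel (R : Type) [Ring R] (ε : R) : R → R → Prop := fun x y => x = ε ∧ y = 0

/-- The quotient ring `R/RεR`. -/
def QuotBy (R : Type) [Ring R] (ε : R) := RingQuot (QuotRel R ε)

instance (R : Type) [Ring R] (ε : R) : Ring (QuotBy R ε) :=
  inferInstanceAs (Ring (RingQuot (QuotRel R ε)))

/-- The canonical projection `R → R/RεR`. -/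
def qmap (R : Type) [Ring R] (ε : R) : R →+* QuotBy R ε := RingQuot.mkRingHom (QuotRel R ε)

/-- The right ideal `xR`, as a right `R`-module (i.e. an `Rᵐᵒᵖ`-submodule of `R`). -/
def rIdeal (R : Type) [Ring R] (x : R) : Submodule Rᵐᵒᵖ R := Submodule.span Rᵐᵒᵖ {x}

/-- Restriction of scalars along `π : R →+* S` turns a right `S`-module into a
right `R`-module. -/
def modRestrict {R S : Type} [Ring R] [Ring S] (π : R →+* S) (M : Type)
    [AddCommGroup M] [Module Sᵐᵒᵖ M] : Module Rᵐᵒᵖ M :=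
  Module.compHom M (RingHom.op π)

/-- `M` is a Gorenstein projective right `R`-module:  there is a complete
resolution, i.e. an exact sequence `⋯ → P⁻² → P⁻¹ → P⁰ → P¹ → ⋯` of finitely
generated projective right `R`-modules which stays exact after applying
`Hom_R(-, R)`, with `M ≅ Im(P⁻¹ → P⁰)`. -/
def IsGProjMod (R : Type) [Ring R] (M : Type) [AddCommGroup M] [Module Rᵐᵒᵖ M] : Prop :=
  ∃ (P : ℤ → ModuleCat.{0} Rᵐᵒᵖ) (d : (n : ℤ) → (P n →ₗ[Rᵐᵒᵖ] P (n + 1))),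
    (∀ n, Module.Finite Rᵐᵒᵖ (P n)) ∧
    (∀ n, Module.Projective Rᵐᵒᵖ (P n)) ∧
    (∀ n, LinearMap.range (d n) = LinearMap.ker (d (n + 1))) ∧
    (∀ (n : ℤ) (g : P (n + 1) →ₗ[Rᵐᵒᵖ] R),
      g.comp (d n) = 0 ↔ ∃ h : P (n + 1 + 1) →ₗ[Rᵐᵒᵖ] R, h.comp (d (n + 1)) = g) ∧
    Nonempty (M ≃ₗ[Rᵐᵒᵖ] LinearMap.range (d (-1)))

/-- `M` is an indecomposable `S`-module. -/
def IsIndec (S : Type) [Ring S] (M : Type) [AddCommGroup M] [Module S M] : Prop :=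
  Nontrivial M ∧ ∀ N₁ N₂ : Submodule S M, IsCompl N₁ N₂ → N₁ = ⊥ ∨ N₂ = ⊥

/-- `M` is a non-projective indecomposable Gorenstein projective right `R`-module. -/
def IsNPIGProj (R : Type) [Ring R] (M : Type) [AddCommGroup M] [Module Rᵐᵒᵖ M] : Prop :=
  IsGProjMod R M ∧ IsIndec Rᵐᵒᵖ M ∧ ¬ Module.Projective Rᵐᵒᵖ M

/-- A right `S`-module `M`, viewed as a right `R`-module along `π : R →+* S`, is a
non-projective indecomposable Gorenstein projective right `R`-module. -/
def RestrIsNPIGProj {R S : Type} [Ring R] [Ring S] (π : R →+* S) (M : Type)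
    [AddCommGroup M] [Module Sᵐᵒᵖ M] : Prop :=
  letI := modRestrict π M
  IsNPIGProj R M

/-- The submodule `M·(RεR)` of a right `R`-module `M`;  the quotient
`M ⧸ M·(RεR)` realizes the tensor product `M ⊗_R R/RεR`. -/
def smulIdeal (R : Type) [Ring R] (ε : R) (M : Type) [AddCommGroup M]
    [Module Rᵐᵒᵖ M] : Submodule Rᵐᵒᵖ M :=
  Submodule.span Rᵐᵒᵖ {m | ∃ (x : M) (a b : R), m = (op (a * ε * b)) • x}

/-- `S` has finitely many finitely generated indecomposable modules up to
isomorphism.  (Applied with `S = Aᵐᵒᵖ` this says `A` is representation-finite.) -/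
def RepFinite (S : Type) [Ring S] : Prop :=
  ∃ (n : ℕ) (M : Fin n → ModuleCat.{0} S), ∀ N : ModuleCat.{0} S,
    Module.Finite S N → IsIndec S N → ∃ i, Nonempty (N ≃ₗ[S] M i)

/-- A cycle in the underlying undirected graph of `Q`:  a closed walk of
length ≥ 1 along edges (each traversed forwards or backwards) with pairwise
distinct vertices and pairwise distinct edges. -/
structure UCycle (Q : QuiverData) where
  len : ℕ
  len1 : 1 ≤ len
  edges : ℕ → Fin Q.nE
  dir : ℕ → Bool
  vert : ℕ → Fin Q.nV
  pe : ∀ i, edges (i + len) = edges i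
  pd : ∀ i, dir (i + len) = dir i
  pv : ∀ i, vert (i + len) = vert i
  incid_t : ∀ i, dir i = true →
    Q.src (edges i) = vert i ∧ Q.tgt (edges i) = vert (i + 1)
  incid_f : ∀ i, dir i = false →
    Q.tgt (edges i) = vert i ∧ Q.src (edges i) = vert (i + 1)
  vdist : ∀ i j, i < len → j < len → vert i = vert j → i = j
  edist : ∀ i j, i < len → j < len → edges i = edges j → i = j

/-- The set of edges of an undirected cycle. -/
def UCycle.edgeSet {Q : QuiverData} (C : UCycle Q) : Set (Fin Q.nE) :=
  {e | ∃ i < C.len, C.edges i = e}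

/-- The underlying graph of `Q` has exactly one cycle. -/
def OneCycle (Q : QuiverData) : Prop :=
  Nonempty (UCycle Q) ∧ ∀ C C' : UCycle Q, C.edgeSet = C'.edgeSet

/-- The projective dimension of (the module underlying) `M` is at most `n`. -/
def projDimLE (S : Type) [Ring S] : ℕ → ModuleCat.{0} S → Prop
  | 0, M => Module.Projective S M
  | n + 1, M => ∃ (P : ModuleCat.{0} S) (f : P →ₗ[S] M), Module.Projective S P ∧
      Function.Surjective f ∧ projDimLE S n (ModuleCat.of S (LinearMap.ker f))

/-- The injective dimension of (the module underlying) `M` is at most `n`. -/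
def injDimLE (S : Type) [Ring S] : ℕ → ModuleCat.{0} S → Prop
  | 0, M => Module.Injective S M
  | n + 1, M => ∃ (J : ModuleCat.{0} S) (f : M →ₗ[S] J), Module.Injective S J ∧
      Function.Injective f ∧ injDimLE S n (ModuleCat.of S (J ⧸ LinearMap.range f))

end

/-- The right `R/RεR`-module `N` realizes the tensor product `M ⊗_R R/RεR` of the
right `R`-module `M`:  the restriction of scalars of `N` along `R → R/RεR` is
isomorphic, as a right `R`-module, to `M ⧸ M·(RεR)` (which is the standard
realization of `M ⊗_R R/RεR`). -/
def RealizesTensor (R : Type) [Ring R] (ε : R) (M : Type) [AddCommGroup M]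
    [Module Rᵐᵒᵖ M] (N : Type) [AddCommGroup N] [Module (QuotBy R ε)ᵐᵒᵖ N] : Prop :=
  letI := modRestrict (qmap R ε) N
  Nonempty ((M ⧸ smulIdeal R ε M) ≃ₗ[Rᵐᵒᵖ] N)

section FiniteGlobalDimension

open CategoryTheory

variable {S : Type} [Ring S]

/-- The module `M` has projective dimension less than `n`. -/
abbrev PDLT (S : Type) [Ring S] (M : Type) [AddCommGroup M] [Module S M] (n : ℕ) : Prop :=
  HasProjectiveDimensionLT (ModuleCat.of S M) n

variable {M N : Type} [AddCommGroup M] [Module S M] [AddCommGroup N] [Module S N]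

theorem PDLT.mono {m n : ℕ} (h : PDLT S M m) (hmn : m ≤ n) : PDLT S M n :=
  hasProjectiveDimensionLT_of_ge _ m n hmn

theorem PDLT.of_subsingleton [Subsingleton M] : PDLT S M 0 :=
  (ModuleCat.isZero_of_subsingleton _).hasProjectiveDimensionLT_zero

theorem pdlt_one_iff : PDLT S M 1 ↔ Module.Projective S M := by
  rw [PDLT, ← projective_iff_hasProjectiveDimensionLT_one, ← IsProjective.iff_projective]

theorem PDLT.of_ker_of_codomain {f : M →ₗ[S] N} (hf : Function.Surjective f) {n : ℕ}
    (hker : PDLT S (LinearMap.ker f) n) (hN : PDLT S N n) : PDLT S M n :=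
  (LinearMap.shortExact_shortComplexKer hf).hasProjectiveDimensionLT_X₂ n hker hN

theorem PDLT.codomain {f : M →ₗ[S] N} (hf : Function.Surjective f) {n : ℕ}
    (hker : PDLT S (LinearMap.ker f) n) (hM : PDLT S M (n + 1)) : PDLT S N (n + 1) :=
  (LinearMap.shortExact_shortComplexKer hf).hasProjectiveDimensionLT_X₃ n hker hM

theorem PDLT.ker {f : M →ₗ[S] N} (hf : Function.Surjective f) {n : ℕ}
    (hM : PDLT S M n) (hN : PDLT S N (n + 1)) : PDLT S (LinearMap.ker f) n :=
  (LinearMap.shortExact_shortComplexKer hf).hasProjectiveDimensionLT_X₁ n hM hN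

/-- Over a ring of finite global dimension, the images in a doubly infinite exact sequence of
projective modules are projective. -/
theorem projective_range_of_exact (N : ℕ)
    (hS : ∀ (M : Type) [AddCommGroup M] [Module S M], PDLT S M N)
    (P : ℤ → Type) [∀ n, AddCommGroup (P n)] [∀ n, Module S (P n)]
    [∀ n, Module.Projective S (P n)] (d : (n : ℤ) → P n →ₗ[S] P (n + 1))
    (hd : ∀ n, LinearMap.range (d n) = LinearMap.ker (d (n + 1))) (n : ℤ) :
    Module.Projective S (LinearMap.range (d n)) := by
  have descent : ∀ m : ℕ, (∀ n, PDLT S (LinearMap.range (d n)) (m + 1)) →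
      ∀ n, PDLT S (LinearMap.range (d n)) 1 := by
    intro m
    induction m with
    | zero => exact id
    | succ m ih =>
      refine fun h => ih fun n => ?_
      rw [hd, ← LinearMap.ker_rangeRestrict]
      exact PDLT.ker (LinearMap.surjective_rangeRestrict _)
        ((pdlt_one_iff.2 inferInstance).mono (by lia)) (h (n + 1))
  exact pdlt_one_iff.1 (descent N (fun n => (hS _).mono (by lia)) n)

end FiniteGlobalDimension

section Triangular

/-- The idempotents `e i` exhibit `S` as a triangular `k`-algebra with diagonal entries `k`, with
respect to the ordering of the index set by `rk`. -/
structure IsTriangular (k S : Type) [Field k] [Ring S] [Algebra k S] {ι : Type} [Fintype ι]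
    (e : ι → S) (rk : ι → ℕ) : Prop where
  idem : ∀ i, e i * e i = e i
  sum_eq_one : ∑ i, e i = 1
  rk_injective : Function.Injective rk
  mul_eq_zero : ∀ i j s, rk j < rk i → e j * s * e i = 0
  diag : ∀ i s, ∃ c : k, e i * s * e i = c • e i

variable {k S : Type} [Field k] [Ring S] [Algebra k S] {ι : Type} [Fintype ι]
  {e : ι → S} {rk : ι → ℕ}

theorem projective_span_of_idem {f : S} (hf : f * f = f) :
    Module.Projective S (Submodule.span S {f}) := by
  refine Module.Projective.of_split (M := S) (Submodule.subtype _)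
    (LinearMap.toSpanSingleton S _ ⟨f, Submodule.mem_span_singleton_self f⟩) ?_
  ext ⟨x, hx⟩
  obtain ⟨a, rfl⟩ := Submodule.mem_span_singleton.1 hx
  simp [mul_assoc, hf]

namespace IsTriangular

theorem exists_sub_smul_mem_ker (h : IsTriangular k S e rk) (i : ι) (M : Type) [AddCommGroup M]
    [Module S M] (hM : ∀ j, rk j < rk i → ∀ m : M, e j • m = 0) :
    ∃ (κ : Type) (φ : (κ →₀ Submodule.span S {e i}) →ₗ[S] M),
      (∀ j, rk j ≤ rk i → ∀ x, φ x = 0 → e j • x = 0) ∧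
      (∀ j, rk j ≤ rk i → ∀ m, e j • m ∈ LinearMap.range φ) := by
  let _ : Module k M := Module.compHom M (algebraMap k S)
  have : IsScalarTower k S M := ⟨fun c s m => by
    rw [Algebra.smul_def, mul_smul]; rfl⟩
  let W : Submodule k M :=
    { carrier := {m | e i • m = m}
      add_mem' := fun {a b} ha hb => by
        simp only [Set.mem_ofPred_eq] at *; rw [smul_add, ha, hb]
      zero_mem' := smul_zero _
      smul_mem' := fun c m hm => by
        simp only [Set.mem_ofPred_eq] at *
        rw [← algebraMap_smul S c m, ← mul_smul, ← Algebra.commutes, mul_smul, hm] }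
  have hW : ∀ w : W, e i • (w : M) = w := fun w => w.2
  let b := Module.Basis.ofVectorSpace k W
  let ei : Submodule.span S {e i} := ⟨e i, Submodule.mem_span_singleton_self _⟩
  let φ : (Module.Basis.ofVectorSpaceIndex k W →₀ Submodule.span S {e i}) →ₗ[S] M :=
    Finsupp.lsum ℕ fun l =>
      (LinearMap.toSpanSingleton S M (b l : M)).comp (Submodule.subtype _)
  have hφ : ∀ x, φ x = x.sum fun l y => (y : S) • (b l : M) := fun x => rfl
  refine ⟨_, φ, ?_, ?_⟩
  · intro j hj x hx
    have key : ∀ l, ∃ c : k, e i * (x l : S) = c • e i := fun l => by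
      obtain ⟨s, hs⟩ := Submodule.mem_span_singleton.1 (x l).2
      rw [← hs, smul_eq_mul, ← mul_assoc]
      exact h.diag i s
    choose c hc using key
    rcases hj.lt_or_eq with hlt | heq
    · ext l
      obtain ⟨s, hs⟩ := Submodule.mem_span_singleton.1 (x l).2
      rw [Finsupp.smul_apply, Submodule.coe_smul, ← hs, smul_eq_mul, smul_eq_mul, ← mul_assoc,
        h.mul_eq_zero i j s hlt]
      rfl
    · obtain rfl := h.rk_injective heq
      have h0 : ∑ l ∈ x.support, c l • b l = 0 := by
        apply Subtype.ext
        have : e j • φ x = 0 := by rw [hx, smul_zero]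
        rw [hφ, Finsupp.sum, Finset.smul_sum] at this
        rw [Submodule.coe_sum, Submodule.coe_zero, ← this]
        refine Finset.sum_congr rfl fun l _ => ?_
        rw [← mul_smul, hc, smul_assoc, hW, Submodule.coe_smul]
      have h1 := linearIndependent_iff'.1 b.linearIndependent _ _ h0
      ext l
      rw [Finsupp.smul_apply, Submodule.coe_smul, smul_eq_mul]
      by_cases hl : l ∈ x.support
      · rw [hc, h1 l hl, zero_smul]; rfl
      · rw [Finsupp.notMem_support_iff.1 hl]; simp
  · intro j hj m
    rcases hj.lt_or_eq with hlt | heq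
    · rw [hM j hlt]; exact Submodule.zero_mem _
    · obtain rfl := h.rk_injective heq
      have hb : ∀ l, (b l : M) ∈ (LinearMap.range φ).restrictScalars k := fun l =>
        ⟨Finsupp.single l ei, by
          rw [hφ, Finsupp.sum_single_index (by simp)]; exact hW _⟩
      have hm : e j • m ∈ W := by
        change e j • e j • m = e j • m
        rw [← mul_smul, h.idem]
      have hle : (⊤ : Submodule k W) ≤
          ((LinearMap.range φ).restrictScalars k).comap W.subtype := by
        rw [← b.span_eq, Submodule.span_le]
        rintro _ ⟨l, rfl⟩
        exact hb l
      exact hle (x := ⟨_, hm⟩) trivial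

theorem pdlt (h : IsTriangular k S e rk) {N : ℕ} (hN : ∀ i, rk i < N) (d : ℕ) :
    ∀ (M : Type) [AddCommGroup M] [Module S M],
      (∀ i, rk i + d < N → ∀ m : M, e i • m = 0) → PDLT S M d := by
  induction d with
  | zero =>
    intro M _ _ hM
    have : Subsingleton M := subsingleton_of_forall_eq 0 fun m => by
      rw [← one_smul S m, ← h.sum_eq_one, Finset.sum_smul]
      exact Finset.sum_eq_zero fun i _ => hM i (hN i) m
    exact PDLT.of_subsingleton
  | succ d ih =>
    intro M _ _ hM
    by_cases hi : ∃ i, rk i + (d + 1) = N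
    · obtain ⟨i, hi⟩ := hi
      obtain ⟨κ, φ, hker, hrange⟩ :=
        h.exists_sub_smul_mem_ker i M fun j hj => hM j (by lia)
      have hF : PDLT S (κ →₀ Submodule.span S {e i}) 1 := by
        classical
        have := projective_span_of_idem (h.idem i)
        exact pdlt_one_iff.2 (Module.Projective.of_equiv' (finsuppLequivDFinsupp S).symm)
      have h1 : PDLT S (LinearMap.range φ) (d + 1) := by
        refine PDLT.codomain (LinearMap.surjective_rangeRestrict φ) ?_ (hF.mono (by lia))
        rw [LinearMap.ker_rangeRestrict]
        refine ih _ fun j hj x => Subtype.ext (hker j (by lia) _ x.2)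
      refine PDLT.of_ker_of_codomain (LinearMap.range φ).mkQ_surjective ?_ ?_
      · rwa [Submodule.ker_mkQ]
      · refine (ih _ fun j hj x => ?_).mono d.le_succ
        obtain ⟨m, rfl⟩ := (LinearMap.range φ).mkQ_surjective x
        rw [← map_smul, Submodule.mkQ_apply, Submodule.Quotient.mk_eq_zero]
        exact hrange j (by lia) m
    · refine (ih M fun i hid => hM i ?_).mono d.le_succ
      have := fun hh => hi ⟨i, hh⟩
      lia

theorem exists_pdlt (h : IsTriangular k S e rk) :
    ∃ N, ∀ (M : Type) [AddCommGroup M] [Module S M], PDLT S M N := by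
  refine ⟨∑ i, rk i + 1, fun M _ _ => h.pdlt (N := ∑ i, rk i + 1) (fun i => ?_) _ M fun i hi => by lia⟩
  have := Finset.single_le_sum (f := rk) (fun _ _ => Nat.zero_le _) (Finset.mem_univ i)
  lia

/-- A nonzero projective module over a triangular algebra maps onto one of the indecomposable
projectives `S e i`. -/
theorem exists_surjective (h : IsTriangular k S e rk) (P : Type) [AddCommGroup P] [Module S P]
    [Module.Projective S P] [Nontrivial P] :
    ∃ (i : ι) (f : P →ₗ[S] Submodule.span S {e i}), e i ≠ 0 ∧ Function.Surjective f := by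
  classical
  have hex : ∃ n i, rk i = n ∧ ∃ x : P, e i • x ≠ 0 := by
    by_contra! hcon
    obtain ⟨x, hx⟩ := exists_ne (0 : P)
    refine hx ?_
    rw [← one_smul S x, ← h.sum_eq_one, Finset.sum_smul]
    exact Finset.sum_eq_zero fun i _ => hcon _ i rfl x
  obtain ⟨i, hi, x, hx⟩ := Nat.find_spec hex
  have hmin : ∀ j, rk j < rk i → ∀ y : P, e j • y = 0 := fun j hj y => by
    by_contra hy
    exact Nat.find_min hex (hi ▸ hj) ⟨j, rfl, y, hy⟩
  obtain ⟨s, hs⟩ := Module.projective_def.1 ‹Module.Projective S P›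
  have hcorner : ∀ (a : S) (p : P), (e i * a) • p = (e i * a * e i) • p := fun a p => by
    conv_lhs => rw [← mul_one (e i * a), ← h.sum_eq_one, Finset.mul_sum, Finset.sum_smul]
    refine Finset.sum_eq_single i (fun j _ hji => ?_) (by simp)
    rcases lt_or_gt_of_ne (h.rk_injective.ne hji) with hlt | hgt
    · rw [mul_smul, hmin j hlt, smul_zero]
    · rw [h.mul_eq_zero j i a hgt, zero_smul]
  obtain ⟨p, hp⟩ : ∃ p, e i * s x p * e i ≠ 0 := by
    by_contra! hcon
    refine hx ?_
    rw [← hs (e i • x), Finsupp.linearCombination_apply]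
    refine Finset.sum_eq_zero fun p _ => ?_
    simp only [map_smul, Finsupp.smul_apply, smul_eq_mul, hcorner, hcon, zero_smul]
  obtain ⟨c, hc⟩ := h.diag i (s x p)
  have hc0 : c ≠ 0 := by
    rintro rfl
    exact hp (by rw [hc, zero_smul])
  let ei : Submodule.span S {e i} := ⟨e i, Submodule.mem_span_singleton_self _⟩
  let f : P →ₗ[S] Submodule.span S {e i} :=
    (LinearMap.toSpanSingleton S _ ei).comp ((Finsupp.lapply p).comp s)
  have hf : ∀ z, (f z : S) = s z p * e i := fun z => rfl
  refine ⟨i, f, fun h0 => hp (by rw [h0, mul_zero]), fun y => ?_⟩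
  obtain ⟨a, ha⟩ := Submodule.mem_span_singleton.1 y.2
  refine ⟨a • algebraMap k S c⁻¹ • e i • x, Subtype.ext ?_⟩
  rw [map_smul, map_smul, Submodule.coe_smul, Submodule.coe_smul, hf, map_smul,
    Finsupp.smul_apply, smul_eq_mul (e i), hc, algebraMap_smul, smul_smul,
    inv_mul_cancel₀ hc0, one_smul, ha]

end IsTriangular

end Triangular

section Lifting

/-- `G ⊗ R/RεR ≅ N` for some finitely generated projective right `R`-module `G`, where the
isomorphism is encoded by the induced map `G → N`. -/
def LiftsToProjective (R : Type) [Ring R] (ε : R) (N : Type) [AddCommGroup N]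
    [Module (QuotBy R ε)ᵐᵒᵖ N] : Prop :=
  ∃ (G : Type) (_ : AddCommGroup G) (_ : Module Rᵐᵒᵖ G), Module.Finite Rᵐᵒᵖ G ∧
    Module.Projective Rᵐᵒᵖ G ∧ ∃ q : G →+ N,
      (∀ (a : R) (g : G), q (op a • g) = op (qmap R ε a) • q g) ∧ Function.Surjective q ∧
        ∀ g, q g = 0 → g ∈ smulIdeal R ε G

variable {R : Type} [Ring R] {ε : R}

theorem qmap_self (R : Type) [Ring R] (ε : R) : qmap R ε ε = 0 := by
  rw [← map_zero (qmap R ε)]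
  exact RingQuot.mkRingHom_rel ⟨rfl, rfl⟩

theorem qmap_surjective (R : Type) [Ring R] (ε : R) : Function.Surjective (qmap R ε) :=
  RingQuot.mkRingHom_surjective _

theorem mem_closure_of_qmap_eq_zero {x : R} (hx : qmap R ε x = 0) :
    x ∈ AddSubgroup.closure {y | ∃ a b : R, y = a * ε * b} := by
  let I := TwoSidedIdeal.span ({ε} : Set R)
  have hmk : ∀ y, I.ringCon.mk' y = 0 ↔ y ∈ I := fun y => by
    rw [← map_zero I.ringCon.mk', TwoSidedIdeal.mem_iff]
    exact RingCon.eq _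
  have hrel : ∀ ⦃y z⦄, QuotRel R ε y z → I.ringCon.mk' y = I.ringCon.mk' z := by
    rintro _ _ ⟨rfl, rfl⟩
    rw [map_zero, hmk]
    exact TwoSidedIdeal.subset_span rfl
  have hxI : x ∈ I := by
    rw [← hmk, ← RingQuot.lift_mkRingHom_apply I.ringCon.mk' hrel]
    exact (congrArg _ hx).trans (map_zero _)
  rw [TwoSidedIdeal.mem_span_iff_mem_addSubgroup_closure] at hxI
  refine AddSubgroup.closure_mono ?_ hxI
  rintro _ ⟨_, ⟨a, -, _, rfl, rfl⟩, b, -, rfl⟩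
  exact ⟨a, b, rfl⟩

/-- Finitely generated projective modules are Gorenstein projective. -/
theorem isGProjMod_of_projective (G : Type) [AddCommGroup G] [Module Rᵐᵒᵖ G]
    [Module.Finite Rᵐᵒᵖ G] [Module.Projective Rᵐᵒᵖ G] : IsGProjMod R G := by
  let d : G × G →ₗ[Rᵐᵒᵖ] G × G := (LinearMap.inr _ G G).comp (LinearMap.fst _ G G)
  have hd : ∀ x, d x = (0, x.1) := fun _ => rfl
  refine ⟨fun _ => ModuleCat.of Rᵐᵒᵖ (G × G), fun _ => d, fun _ => ?_, fun _ => ?_, fun _ => ?_,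
    fun _ g => ⟨fun hg => ?_, ?_⟩, ?_⟩
  · exact inferInstanceAs (Module.Finite Rᵐᵒᵖ (G × G))
  · exact inferInstanceAs (Module.Projective Rᵐᵒᵖ (G × G))
  · ext ⟨x, y⟩
    simp only [LinearMap.mem_range, LinearMap.mem_ker, hd, Prod.ext_iff]
    constructor
    · rintro ⟨z, h1, -⟩
      exact ⟨rfl, h1.symm⟩
    · rintro ⟨-, h⟩
      exact ⟨(y, 0), h.symm, rfl⟩
  · refine ⟨LinearMap.comp (M₂ := G × G) g
      ((LinearMap.inl _ G G).comp (LinearMap.snd _ G G)), ?_⟩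
    refine LinearMap.ext fun (x : G × G) => ?_
    have h1 : g ((0, x.2) : G × G) = 0 := LinearMap.congr_fun hg ((x.2, 0) : G × G)
    have h2 : g x = g ((x.1, 0) : G × G) + g ((0, x.2) : G × G) := by
      rw [← map_add]
      exact congrArg g (Prod.ext (add_zero x.1).symm (zero_add x.2).symm)
    exact (by rw [h2, h1, add_zero] : g ((x.1, 0) : G × G) = g x)
  · rintro ⟨h, rfl⟩
    exact LinearMap.ext fun _ => map_zero h
  · refine ⟨(LinearEquiv.ofInjective (LinearMap.inr Rᵐᵒᵖ G G) LinearMap.inr_injective).trans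
      (LinearEquiv.ofEq _ _ ?_)⟩
    ext x
    constructor
    · rintro ⟨y, rfl⟩
      exact ⟨((y, 0) : G × G), rfl⟩
    · rintro ⟨y, rfl⟩
      exact ⟨Prod.fst (α := G) y, rfl⟩

theorem RealizesTensor.of_map (G : Type) [AddCommGroup G] [Module Rᵐᵒᵖ G] (N : Type)
    [AddCommGroup N] [Module (QuotBy R ε)ᵐᵒᵖ N] (q : G →+ N)
    (hq : ∀ (a : R) (g : G), q (op a • g) = op (qmap R ε a) • q g)
    (hsurj : Function.Surjective q) (hker : ∀ g, q g = 0 → g ∈ smulIdeal R ε G) :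
    RealizesTensor R ε G N := by
  let _ : Module Rᵐᵒᵖ N := modRestrict (qmap R ε) N
  let f : G →ₗ[Rᵐᵒᵖ] N := { q with map_smul' := fun a g => hq a.unop g }
  have hf : smulIdeal R ε G = LinearMap.ker f := by
    refine le_antisymm (Submodule.span_le.2 ?_) hker
    rintro _ ⟨x, a, b, rfl⟩
    change q _ = 0
    rw [hq, map_mul, map_mul, qmap_self, mul_zero, zero_mul, op_zero, zero_smul]
  exact ⟨(Submodule.quotEquivOfEq _ _ hf).trans (f.quotKerEquivOfSurjective hsurj)⟩

namespace LiftsToProjective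

variable {N N₁ N₂ : Type} [AddCommGroup N] [Module (QuotBy R ε)ᵐᵒᵖ N]
  [AddCommGroup N₁] [Module (QuotBy R ε)ᵐᵒᵖ N₁] [AddCommGroup N₂] [Module (QuotBy R ε)ᵐᵒᵖ N₂]

theorem of_equiv (j : N₁ ≃ₗ[(QuotBy R ε)ᵐᵒᵖ] N) (h : LiftsToProjective R ε N₁) :
    LiftsToProjective R ε N := by
  obtain ⟨G, _, _, hfin, hproj, q, hq, hsurj, hker⟩ := h
  refine ⟨G, _, _, hfin, hproj, (j : N₁ →+ N).comp q, fun a g => ?_,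
    j.surjective.comp hsurj, fun g hg => hker g (j.map_eq_zero_iff.1 hg)⟩
  exact (congrArg j (hq a g)).trans (map_smul j _ _)

theorem of_subsingleton [Subsingleton N] : LiftsToProjective R ε N :=
  ⟨PUnit, inferInstance, inferInstance, inferInstance, inferInstance, 0,
    fun _ _ => Subsingleton.elim _ _, fun _ => ⟨0, Subsingleton.elim _ _⟩,
    fun _ _ => Submodule.zero_mem _⟩

theorem map_mem_smulIdeal {G G' : Type} [AddCommGroup G] [Module Rᵐᵒᵖ G] [AddCommGroup G']
    [Module Rᵐᵒᵖ G'] (f : G →ₗ[Rᵐᵒᵖ] G') {g : G} (hg : g ∈ smulIdeal R ε G) :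
    f g ∈ smulIdeal R ε G' := by
  have hle : smulIdeal R ε G ≤ (smulIdeal R ε G').comap f := by
    refine Submodule.span_le.2 ?_
    rintro _ ⟨x, a, b, rfl⟩
    exact Submodule.subset_span ⟨f x, a, b, map_smul f _ _⟩
  exact hle hg

theorem prod (h₁ : LiftsToProjective R ε N₁) (h₂ : LiftsToProjective R ε N₂) :
    LiftsToProjective R ε (N₁ × N₂) := by
  obtain ⟨G₁, _, _, hfin₁, hproj₁, q₁, hq₁, hsurj₁, hker₁⟩ := h₁
  obtain ⟨G₂, _, _, hfin₂, hproj₂, q₂, hq₂, hsurj₂, hker₂⟩ := h₂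
  refine ⟨G₁ × G₂, inferInstance, inferInstance, inferInstance, inferInstance,
    q₁.prodMap q₂, fun a g => Prod.ext (hq₁ a g.1) (hq₂ a g.2), hsurj₁.prodMap hsurj₂,
    fun g hg => ?_⟩
  have h1 := map_mem_smulIdeal (LinearMap.inl Rᵐᵒᵖ G₁ G₂) (hker₁ g.1 (congrArg Prod.fst hg))
  have h2 := map_mem_smulIdeal (LinearMap.inr Rᵐᵒᵖ G₁ G₂) (hker₂ g.2 (congrArg Prod.snd hg))
  simpa using Submodule.add_mem _ h1 h2

theorem span_idem {f : R} (hf : f * f = f) :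
    LiftsToProjective R ε (Submodule.span (QuotBy R ε)ᵐᵒᵖ {op (qmap R ε f)}) := by
  have hf' : op f * op f = op f := by rw [← op_mul, hf]
  let q : Submodule.span Rᵐᵒᵖ {op f} →+ Submodule.span (QuotBy R ε)ᵐᵒᵖ {op (qmap R ε f)} :=
    { toFun := fun x => ⟨op (qmap R ε x.1.unop), by
        obtain ⟨x, hx⟩ := x
        obtain ⟨a, rfl⟩ := Submodule.mem_span_singleton.1 hx
        exact Submodule.mem_span_singleton.2 ⟨op (qmap R ε a.unop), by simp⟩⟩
      map_zero' := by simp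
      map_add' := fun x y => by ext; simp }
  refine ⟨_, inferInstance, inferInstance,
    Module.Finite.iff_fg.2 (Submodule.fg_span_singleton (op f)),
    projective_span_of_idem hf', q, fun a x => ?_, fun y => ?_, fun x hx => ?_⟩
  · ext
    simp [q]
  · obtain ⟨y, hy⟩ := y
    obtain ⟨b, rfl⟩ := Submodule.mem_span_singleton.1 hy
    obtain ⟨a, ha⟩ := qmap_surjective R ε b.unop
    refine ⟨⟨op a • op f, Submodule.mem_span_singleton.2 ⟨_, rfl⟩⟩, ?_⟩
    ext
    simp [q, ha]
  · obtain ⟨x, hxf⟩ := x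
    have hfix : f * x.unop = x.unop := by
      obtain ⟨a, rfl⟩ := Submodule.mem_span_singleton.1 hxf
      simp [← mul_assoc, hf]
    have hx0 : qmap R ε x.unop = 0 := by simpa [q] using congrArg Subtype.val hx
    have hcl := mem_closure_of_qmap_eq_zero hx0
    let u : Submodule.span Rᵐᵒᵖ {op f} := ⟨op f, Submodule.mem_span_singleton_self _⟩
    have key : ∀ y ∈ AddSubgroup.closure {y | ∃ a b : R, y = a * ε * b},
        op y • u ∈ smulIdeal R ε (Submodule.span Rᵐᵒᵖ {op f}) := fun y hy => by
      induction hy using AddSubgroup.closure_induction with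
      | mem y hy =>
        obtain ⟨a, b, rfl⟩ := hy
        exact Submodule.subset_span ⟨u, a, b, rfl⟩
      | zero => rw [op_zero, zero_smul]; exact Submodule.zero_mem _
      | add y z _ _ hy hz => rw [op_add, add_smul]; exact Submodule.add_mem _ hy hz
      | neg y _ hy => rw [op_neg, neg_smul (op y) u]; exact Submodule.neg_mem _ hy
    convert key _ hcl using 1
    exact Subtype.ext (unop_injective (by simp [u, hfix]))

end LiftsToProjective

/-- If the idempotents of a triangular structure on `R/RεR` lift to idempotents of `R`, then all
projective modules over `R/RεR` of finite length lift to projective modules over `R`. -/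
theorem IsTriangular.liftsToProjective {k ι : Type} [Field k] [Fintype ι]
    [Algebra k (QuotBy R ε)ᵐᵒᵖ] {f : ι → R} {rk : ι → ℕ}
    (h : IsTriangular k (QuotBy R ε)ᵐᵒᵖ (fun i => op (qmap R ε (f i))) rk)
    (hf : ∀ i, f i * f i = f i) {P : Type} [AddCommGroup P] [Module (QuotBy R ε)ᵐᵒᵖ P]
    [IsArtinian (QuotBy R ε)ᵐᵒᵖ P] [Module.Projective (QuotBy R ε)ᵐᵒᵖ P] :
    LiftsToProjective R ε P := by
  suffices ∀ N : Submodule (QuotBy R ε)ᵐᵒᵖ P, Module.Projective (QuotBy R ε)ᵐᵒᵖ N →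
      LiftsToProjective R ε N from
    (this ⊤ (Module.Projective.of_equiv' Submodule.topEquiv.symm)).of_equiv Submodule.topEquiv
  intro N
  induction N using WellFoundedLT.induction with
  | ind N ih =>
    intro hN
    rcases subsingleton_or_nontrivial N with hsub | hnt
    · exact LiftsToProjective.of_subsingleton
    obtain ⟨i, g, hi, hg⟩ := h.exists_surjective N
    have := projective_span_of_idem (h.idem i)
    obtain ⟨s, hs⟩ := g.exists_rightInverse_of_surjective (LinearMap.range_eq_top.2 hg)
    have hs' : ∀ x, g (s x) = x := LinearMap.congr_fun hs
    let K := LinearMap.ker g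
    let j : (Submodule.span (QuotBy R ε)ᵐᵒᵖ {op (qmap R ε (f i))} × K) ≃ₗ[(QuotBy R ε)ᵐᵒᵖ] N :=
      LinearEquiv.ofBijective (s.coprod K.subtype) (by
        refine ⟨(injective_iff_map_eq_zero _).2 ?_, fun y => ?_⟩
        · rintro ⟨x, y⟩ hxy
          have hxy' : s x + (y : N) = 0 := hxy
          have hx : x = 0 := by
            have := congrArg g hxy'
            rwa [map_add, hs', LinearMap.mem_ker.1 y.2, add_zero, map_zero] at this
          subst hx
          rw [map_zero, zero_add] at hxy'
          exact Prod.ext rfl (Subtype.ext hxy')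
        · refine ⟨(g y, ⟨y - s (g y), ?_⟩), ?_⟩
          · rw [LinearMap.mem_ker, map_sub, hs', sub_self]
          · simp)
    have hKproj : Module.Projective (QuotBy R ε)ᵐᵒᵖ K :=
      Module.Projective.of_split (j.toLinearMap.comp (LinearMap.inr _ _ _) : K →ₗ[_] N)
        ((LinearMap.snd _ _ _).comp j.symm.toLinearMap) (by ext x; simp)
    let m := Submodule.equivMapOfInjective N.subtype N.injective_subtype K
    have hlt : K.map N.subtype < N := by
      refine lt_of_le_of_ne (Submodule.map_subtype_le N K) fun heq => ?_
      obtain ⟨x, hx⟩ := hg ⟨_, Submodule.mem_span_singleton_self _⟩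
      have hxK : (x : P) ∈ K.map N.subtype := by rw [heq]; exact x.2
      obtain ⟨y, hy, hyx⟩ := hxK
      obtain rfl : y = x := Subtype.ext hyx
      exact hi (congrArg Subtype.val (hx.symm.trans hy))
    have hK : LiftsToProjective R ε K :=
      (ih _ hlt (Module.Projective.of_equiv' m)).of_equiv m.symm
    exact ((LiftsToProjective.span_idem (hf i)).prod hK).of_equiv j

end Lifting

section Quiver

theorem exists_injective_rank {n : ℕ} (r : Fin n → Fin n → Prop) (hr : WellFounded r) :
    ∃ rk : Fin n → ℕ, Function.Injective rk ∧ ∀ v w, r v w → rk v < rk w := by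
  classical
  let p : Fin n → Finset (Fin n) := fun v => Finset.univ.filter fun u => Relation.TransGen r u v
  refine ⟨fun v => (p v).card * n + v, fun v w hvw => ?_, fun v w hvw => ?_⟩
  · have h := congrArg (· % n) hvw
    simp only [Nat.mul_add_mod_self_right, Nat.mod_eq_of_lt v.2, Nat.mod_eq_of_lt w.2] at h
    exact Fin.ext h
  · have hlt : (p v).card < (p w).card := by
      refine Finset.card_lt_card ((Finset.ssubset_iff_of_subset fun u hu => ?_).2 ⟨v, ?_, ?_⟩)
      · simp only [p, Finset.mem_filter, Finset.mem_univ, true_and] at hu ⊢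
        exact hu.tail hvw
      · simpa [p] using Relation.TransGen.single hvw
      · simpa [p] using fun hv => hr.transGen.irrefl.irrefl v hv
    have := v.2
    calc (p v).card * n + v < ((p v).card + 1) * n := by rw [add_one_mul]; lia
      _ ≤ (p w).card * n := Nat.mul_le_mul_right _ hlt
      _ ≤ _ := Nat.le_add_right _ _

/-- A quiver relation with an infinite descending chain contains an undirected cycle, all of whose
edges belong to the relation. -/
theorem exists_uCycle_of_not_wellFounded (Q : QuiverData) (E : Set (Fin Q.nE))
    (hE : ¬ WellFounded fun v w => ∃ a ∈ E, Q.src a = v ∧ Q.tgt a = w) :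
    ∃ U : UCycle Q, U.edgeSet ⊆ E := by
  classical
  obtain ⟨f, hf⟩ : ∃ f : ℕ → Fin Q.nV,
      ∀ n, ∃ a ∈ E, Q.src a = f (n + 1) ∧ Q.tgt a = f n := by
    by_contra! hcon
    refine hE (wellFounded_iff_isEmpty_descending_chain.2 ⟨fun ⟨f, hf⟩ => ?_⟩)
    obtain ⟨n, hn⟩ := hcon f
    obtain ⟨a, ha, h1, h2⟩ := hf n
    exact hn a ha h1 h2
  choose g hgE hgs hgt using hf
  have hex : ∃ d, 1 ≤ d ∧ ∃ i, f i = f (i + d) := by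
    obtain ⟨i, j, hij, hfij⟩ := Finite.exists_ne_map_eq_of_infinite f
    rcases lt_or_gt_of_ne hij with h | h
    · exact ⟨j - i, by lia, i, by rw [hfij]; congr 1; lia⟩
    · exact ⟨i - j, by lia, j, by rw [← hfij]; congr 1; lia⟩
  obtain ⟨hd, i, hi⟩ := Nat.find_spec hex
  set d := Nat.find hex
  have hinj : ∀ a b, a < b → b < d → f (i + a) ≠ f (i + b) := fun a b hab hbd heq =>
    Nat.find_min hex (m := b - a) (by lia)
      ⟨by lia, i + a, by rw [heq]; congr 1; lia⟩
  have hinj' : ∀ a b, a < d → b < d → f (i + a) = f (i + b) → a = b := fun a b ha hb heq => by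
    rcases lt_trichotomy a b with h | h | h
    · exact absurd heq (hinj a b h hb)
    · exact h
    · exact absurd heq.symm (hinj b a h ha)
  let U : UCycle Q :=
    { len := d
      len1 := hd
      edges := fun m => g (i + m % d)
      dir := fun _ => false
      vert := fun m => f (i + m % d)
      pe := fun m => by rw [Nat.add_mod_right]
      pd := fun _ => rfl
      pv := fun m => by rw [Nat.add_mod_right]
      incid_t := fun _ h => absurd h (by decide)
      incid_f := fun m _ => ⟨hgt _, by
        rw [hgs, add_assoc]
        have hm := Nat.mod_lt m (show 0 < d from hd)
        rw [Nat.add_mod m 1 d]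
        rcases Nat.lt_or_ge (m % d + 1) d with h | h
        · have : 1 % d = 1 := Nat.mod_eq_of_lt (by lia)
          rw [this, Nat.mod_eq_of_lt h]
        · have hmd : m % d + 1 = d := by lia
          rw [← Nat.add_mod, ← Nat.mod_add_mod, hmd, Nat.mod_self, add_zero, hi]⟩
      vdist := fun a b ha hb h => by
        rw [Nat.mod_eq_of_lt ha, Nat.mod_eq_of_lt hb] at h
        exact hinj' a b ha hb h
      edist := fun a b ha hb h => by
        rw [Nat.mod_eq_of_lt ha, Nat.mod_eq_of_lt hb] at h
        exact hinj' a b ha hb (by rw [← hgt, h, hgt]) }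
  refine ⟨U, ?_⟩
  rintro _ ⟨m, -, rfl⟩
  exact hgE _

instance (k R : Type) [Field k] [Ring R] [Algebra k R] (ε : R) : Algebra k (QuotBy R ε) :=
  inferInstanceAs (Algebra k (RingQuot (QuotRel R ε)))

theorem qmap_algebraMap (k : Type) {R : Type} [Field k] [Ring R] [Algebra k R] (ε : R) (c : k) :
    qmap R ε (algebraMap k R c) = algebraMap k (QuotBy R ε) c := by
  have h := (RingQuot.mkAlgHom k (QuotRel R ε)).commutes c
  have h' := RingHom.congr_fun (RingQuot.mkAlgHom_coe k (QuotRel R ε)) (algebraMap k R c)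
  exact h'.symm.trans h

variable (k : Type) [Field k] (Q : QuiverData) (Rel : Set (Fin Q.nE × Fin Q.nE))

theorem vtx_mul_vtx (v w : Fin Q.nV) :
    vtx k Q v * vtx k Q w = if v = w then vtx k Q v else 0 := by
  have h := RingQuot.mkAlgHom_rel k (PathRel.vtx_mul (k := k) (Q := Q) v w)
  rw [map_mul] at h
  refine h.trans ?_
  split_ifs
  · rfl
  · exact map_zero _

theorem sum_vtx : ∑ v, vtx k Q v = 1 := by
  have h := RingQuot.mkAlgHom_rel k (PathRel.vtx_sum (k := k) (Q := Q))
  rw [map_sum, map_one] at h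
  exact h

theorem vtx_src_mul_arr (a : Fin Q.nE) : vtx k Q (Q.src a) * arr k Q a = arr k Q a := by
  have h := RingQuot.mkAlgHom_rel k (PathRel.src_arr (k := k) (Q := Q) a)
  rw [map_mul] at h
  exact h

theorem arr_mul_vtx_tgt (a : Fin Q.nE) : arr k Q a * vtx k Q (Q.tgt a) = arr k Q a := by
  have h := RingQuot.mkAlgHom_rel k (PathRel.arr_tgt (k := k) (Q := Q) a)
  rw [map_mul] at h
  exact h

theorem vtxA_mul_vtxA (v w : Fin Q.nV) :
    vtxA k Q Rel v * vtxA k Q Rel w = if v = w then vtxA k Q Rel v else 0 := by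
  simp only [vtxA]
  rw [← map_mul, vtx_mul_vtx]
  split_ifs
  · rfl
  · exact map_zero _

theorem vtxA_idem (v : Fin Q.nV) : vtxA k Q Rel v * vtxA k Q Rel v = vtxA k Q Rel v := by
  rw [vtxA_mul_vtxA, if_pos rfl]

theorem sum_vtxA : ∑ v, vtxA k Q Rel v = 1 := by
  simp only [vtxA]
  rw [← map_sum, sum_vtx, map_one]

theorem vtxA_src_mul_arrA (a : Fin Q.nE) :
    vtxA k Q Rel (Q.src a) * arrA k Q Rel a = arrA k Q Rel a := by
  rw [vtxA, arrA, ← map_mul, vtx_src_mul_arr]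

theorem arrA_mul_vtxA_tgt (a : Fin Q.nE) :
    arrA k Q Rel a * vtxA k Q Rel (Q.tgt a) = arrA k Q Rel a := by
  rw [vtxA, arrA, ← map_mul, arr_mul_vtx_tgt]

theorem GAlg.induction {p : GAlg k Q Rel → Prop} (hvtx : ∀ v, p (vtxA k Q Rel v))
    (harr : ∀ a, p (arrA k Q Rel a)) (hscalar : ∀ c : k, p (algebraMap k _ c))
    (hadd : ∀ x y, p x → p y → p (x + y)) (hmul : ∀ x y, p x → p y → p (x * y)) (x) : p x := by
  obtain ⟨y, rfl⟩ : ∃ y, gmap k Q Rel y = x := RingQuot.mkAlgHom_surjective k (GRel k Q Rel) x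
  obtain ⟨z, rfl⟩ : ∃ z, RingQuot.mkAlgHom k (PathRel k Q) z = y :=
    RingQuot.mkAlgHom_surjective k (PathRel k Q) y
  let Φ : FreeAlgebra k (Fin Q.nV ⊕ Fin Q.nE) →ₐ[k] GAlg k Q Rel :=
    (gmap k Q Rel).comp (RingQuot.mkAlgHom k (PathRel k Q) :
      FreeAlgebra k (Fin Q.nV ⊕ Fin Q.nE) →ₐ[k] PathAlg k Q)
  change p (Φ z)
  induction z using FreeAlgebra.induction with
  | grade0 c => rw [AlgHom.commutes]; exact hscalar c
  | grade1 u =>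
    cases u with
    | inl v => exact hvtx v
    | inr a => exact harr a
  | mul x y hx hy => rw [map_mul]; exact hmul _ _ hx hy
  | add x y hx hy => rw [map_add]; exact hadd _ _ hx hy

variable {k Q Rel}

/-- A quotient of a quiver algebra, in which every arrow not increasing the rank of the vertices
vanishes, is triangular. -/
theorem isTriangular_of_rank (ε : GAlg k Q Rel) (rk : Fin Q.nV → ℕ)
    (hinj : Function.Injective rk)
    (harr : ∀ a, qmap _ ε (arrA k Q Rel a) = 0 ∨ rk (Q.src a) < rk (Q.tgt a)) :
    IsTriangular k (QuotBy (GAlg k Q Rel) ε)ᵐᵒᵖ (fun v => op (qmap _ ε (vtxA k Q Rel v))) rk := by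
  let e : Fin Q.nV → QuotBy (GAlg k Q Rel) ε := fun v => qmap _ ε (vtxA k Q Rel v)
  have hee : ∀ v w, e v * e w = if v = w then e v else 0 := fun v w => by
    simp only [e]
    rw [← map_mul, vtxA_mul_vtxA]
    split_ifs
    · rfl
    · exact map_zero _
  have hidem : ∀ v, e v * e v = e v := fun v => by rw [hee, if_pos rfl]
  have hsum : ∑ v, e v = 1 := by
    simp only [e]
    rw [← map_sum, sum_vtxA, map_one]
  have key : ∀ x : GAlg k Q Rel, (∀ i j, rk j < rk i → e i * qmap _ ε x * e j = 0) ∧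
      ∀ i, ∃ c : k, e i * qmap _ ε x * e i = c • e i := by
    intro x
    induction x using GAlg.induction with
    | hvtx v =>
      change (∀ i j, _ → e i * e v * e j = 0) ∧ ∀ i, ∃ c : k, e i * e v * e i = c • e i
      refine ⟨fun i j hij => ?_, fun i => ?_⟩
      · rw [hee]
        split_ifs with h
        · rw [hee, if_neg (fun h' => by simp [h'] at hij)]
        · rw [zero_mul]
      · rw [hee]
        split_ifs with h
        · exact ⟨1, by rw [hidem, one_smul]⟩
        · exact ⟨0, by rw [zero_mul, zero_smul]⟩
    | harr a =>
      have ha : qmap _ ε (arrA k Q Rel a) =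
          e (Q.src a) * qmap _ ε (arrA k Q Rel a) * e (Q.tgt a) := by
        simp only [e]
        rw [← map_mul, ← map_mul, vtxA_src_mul_arrA, arrA_mul_vtxA_tgt]
      have hle : ∀ i j, rk j ≤ rk i → e i * qmap _ ε (arrA k Q Rel a) * e j = 0 := by
        intro i j hij
        rcases harr a with h0 | hlt
        · rw [h0, mul_zero, zero_mul]
        · rw [ha]
          by_cases his : i = Q.src a
          · have hjt : Q.tgt a ≠ j := by
              rintro rfl
              rw [his] at hij
              lia
            rw [mul_assoc, mul_assoc, hee (Q.tgt a), if_neg hjt, mul_zero, mul_zero]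
          · rw [← mul_assoc, ← mul_assoc, hee i, if_neg his, zero_mul, zero_mul, zero_mul]
      exact ⟨fun i j hij => hle i j hij.le, fun i => ⟨0, by rw [hle i i le_rfl, zero_smul]⟩⟩
    | hscalar c =>
      have hc : ∀ i j, e i * algebraMap k _ c * e j = c • (e i * e j) := fun i j => by
        rw [← Algebra.commutes, mul_assoc, Algebra.smul_def]
      rw [qmap_algebraMap]
      refine ⟨fun i j hij => ?_, fun i => ⟨c, by rw [hc, hidem]⟩⟩
      rw [hc, hee, if_neg (fun h' => by simp [h'] at hij), smul_zero]
    | hadd x y hx hy =>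
      rw [map_add]
      refine ⟨fun i j hij => ?_, fun i => ?_⟩
      · rw [mul_add, add_mul, hx.1 i j hij, hy.1 i j hij, add_zero]
      · obtain ⟨c, hc⟩ := hx.2 i
        obtain ⟨c', hc'⟩ := hy.2 i
        exact ⟨c + c', by rw [mul_add, add_mul, hc, hc', add_smul]⟩
    | hmul x y hx hy =>
      rw [map_mul]
      have hsplit : ∀ i j, e i * (qmap _ ε x * qmap _ ε y) * e j =
          ∑ l, (e i * qmap _ ε x * e l) * (e l * qmap _ ε y * e j) := fun i j => by
        have hl : ∀ l, (e i * qmap _ ε x * e l) * (e l * qmap _ ε y * e j) =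
            e i * qmap _ ε x * e l * (qmap _ ε y * e j) := fun l => by
          rw [mul_assoc (e l), ← mul_assoc _ (e l), mul_assoc _ (e l) (e l), hidem]
        rw [Finset.sum_congr rfl fun l _ => hl l, ← Finset.sum_mul, ← Finset.mul_sum, hsum, mul_one]
        simp only [mul_assoc]
      refine ⟨fun i j hij => ?_, fun i => ?_⟩
      · rw [hsplit]
        refine Finset.sum_eq_zero fun l _ => ?_
        rcases lt_or_ge (rk l) (rk i) with h | h
        · rw [hx.1 i l h, zero_mul]
        · rw [hy.1 l j (hij.trans_le h), mul_zero]
      · obtain ⟨c, hc⟩ := hx.2 i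
        obtain ⟨c', hc'⟩ := hy.2 i
        refine ⟨c * c', ?_⟩
        rw [hsplit, Finset.sum_eq_single i (fun l _ hli => ?_) (by simp), hc, hc',
          smul_mul_smul_comm, hidem]
        rcases lt_or_gt_of_ne (hinj.ne hli) with h | h
        · rw [hx.1 i l h, zero_mul]
        · rw [hy.1 l i h, mul_zero]
  have hlift : ∀ s : (QuotBy (GAlg k Q Rel) ε)ᵐᵒᵖ, ∃ x, s = op (qmap _ ε x) := fun s => by
    obtain ⟨x, hx⟩ := qmap_surjective _ ε s.unop
    exact ⟨x, by rw [hx, op_unop]⟩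
  refine ⟨fun i => ?_, ?_, hinj, fun i j s hij => ?_, fun i s => ?_⟩
  · rw [← op_mul]; exact congrArg op (hidem i)
  · rw [← op_one, ← hsum, Finset.op_sum]
  · obtain ⟨x, rfl⟩ := hlift s
    rw [← op_mul, ← op_mul, ← mul_assoc]
    exact congrArg op ((key x).1 i j hij)
  · obtain ⟨x, rfl⟩ := hlift s
    obtain ⟨c, hc⟩ := (key x).2 i
    refine ⟨c, ?_⟩
    rw [← op_mul, ← op_mul, ← mul_assoc, ← op_smul]
    exact congrArg op hc

namespace FRCycle

variable (C : FRCycle k Q Rel) (t : ℕ)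

/-- The vertices of the cycle other than the endpoints of its `t`-th arrow. -/
def removedVertices : Set (Fin Q.nV) :=
  {v | ∃ i < C.len, v = Q.src (C.arrows i) ∧ v ≠ Q.src (C.arrows t) ∧ v ≠ Q.tgt (C.arrows t)}

theorem exists_arrow_removed : ∃ i < C.len, Q.src (C.arrows i) ∈ C.removedVertices t := by
  have hper : Function.Periodic C.arrows C.len := C.periodic
  have hlen := C.len3
  have hpos : 0 < C.len := by lia
  obtain ⟨i, hi, h1, h2⟩ : ∃ i < C.len, i ≠ t % C.len ∧ i ≠ (t + 1) % C.len := by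
    by_contra! hcon
    have h0 := hcon 0
    have h1 := hcon 1
    have h2 := hcon 2
    lia
  refine ⟨i, hi, i, hi, rfl, fun h => h1 ?_, fun h => h2 ?_⟩
  · rw [← hper.map_mod_nat t] at h
    exact C.vinj _ _ hi (Nat.mod_lt _ hpos) h
  · rw [C.comp t, ← hper.map_mod_nat (t + 1)] at h
    exact C.vinj _ _ hi (Nat.mod_lt _ hpos) h

variable {C t}

theorem qmap_vtxA_eq_zero {v : Fin Q.nV} (hv : v ∈ C.removedVertices t) :
    qmap _ (epsCt k Q Rel C t) (vtxA k Q Rel v) = 0 := by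
  obtain ⟨i, hi, rfl, h1, h2⟩ := hv
  have hmul : vtxA k Q Rel (Q.src (C.arrows i)) * epsCt k Q Rel C t =
      vtxA k Q Rel (Q.src (C.arrows i)) := by
    rw [epsCt, Finset.mul_sum, Finset.sum_eq_single i, vtxA_idem]
    · intro j hj hji
      rw [vtxA_mul_vtxA, if_neg fun h => hji (C.vinj _ _ ?_ hi h.symm)]
      exact Finset.mem_range.1 (Finset.mem_filter.1 hj).1
    · intro h
      exact absurd (Finset.mem_filter.2 ⟨Finset.mem_range.2 hi, h1, h2⟩) h
  rw [← hmul, map_mul, qmap_self, mul_zero]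

theorem qmap_arrA_eq_zero {a : Fin Q.nE}
    (ha : Q.src a ∈ C.removedVertices t ∨ Q.tgt a ∈ C.removedVertices t) :
    qmap _ (epsCt k Q Rel C t) (arrA k Q Rel a) = 0 := by
  rcases ha with ha | ha
  · rw [← vtxA_src_mul_arrA, map_mul, qmap_vtxA_eq_zero ha, zero_mul]
  · rw [← arrA_mul_vtxA_tgt, map_mul, qmap_vtxA_eq_zero ha, mul_zero]

theorem exists_isTriangular (honecycle : ∀ C' : UCycle Q, C'.edgeSet = C.arrowSet) :
    ∃ rk, IsTriangular k (QuotBy (GAlg k Q Rel) (epsCt k Q Rel C t))ᵐᵒᵖ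
      (fun v => op (qmap _ (epsCt k Q Rel C t) (vtxA k Q Rel v))) rk := by
  let E : Set (Fin Q.nE) := {a | Q.src a ∉ C.removedVertices t ∧ Q.tgt a ∉ C.removedVertices t}
  have hwf : WellFounded fun v w => ∃ a ∈ E, Q.src a = v ∧ Q.tgt a = w := by
    by_contra hE
    obtain ⟨U, hU⟩ := exists_uCycle_of_not_wellFounded Q E hE
    obtain ⟨i, hi, hsrc⟩ := C.exists_arrow_removed t
    have hmem : C.arrows i ∈ U.edgeSet := by
      rw [honecycle U]
      exact ⟨i, hi, rfl⟩
    exact (hU hmem).1 hsrc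
  obtain ⟨rk, hinj, hrk⟩ := exists_injective_rank _ hwf
  refine ⟨rk, isTriangular_of_rank _ rk hinj fun a => ?_⟩
  by_cases ha : a ∈ E
  · exact Or.inr (hrk _ _ ⟨a, ha, rfl, rfl⟩)
  · refine Or.inl (qmap_arrA_eq_zero ?_)
    by_contra! hcon
    exact ha hcon

end FRCycle

end Quiver

/-- Remark `rmk: rmk of main 2` (2).  Let `A = kQ/I` be a
gentle one-cycle algebra whose unique cycle `𝒞 = a_1 ⋯ a_l` is full-relational
oriented, `t < l`.  Then every (finitely generated) Gorenstein projective right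
`Ā_{𝒞,t}`-module is projective, and the restriction of `T_{𝒞,t} = - ⊗_A Ā_{𝒞,t}`
to Gorenstein projective right `A`-modules surjects onto projective right
`Ā_{𝒞,t}`-modules:  every finitely generated projective right `Ā_{𝒞,t}`-module
is isomorphic to `T_{𝒞,t}(G)` for some finitely generated Gorenstein projective
right `A`-module `G`. -/
theorem stmt14 (k : Type) [Field k] [IsAlgClosed k] (Q : QuiverData)
    (Rel : Set (Fin Q.nE × Fin Q.nE)) (hgentle : IsGentle k Q Rel)
    (hfd : Module.Finite k (GAlg k Q Rel)) (hns : NoShortFRC k Q Rel)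
    (C : FRCycle k Q Rel) (honecycle : ∀ C' : UCycle Q, C'.edgeSet = C.arrowSet)
    (t : ℕ) (ht : t < C.len) :
    let A := GAlg k Q Rel
    let ε := epsCt k Q Rel C t
    let Abar := QuotBy A ε
    (∀ N : ModuleCat.{0} Abarᵐᵒᵖ, Module.Finite Abarᵐᵒᵖ N →
      IsGProjMod Abar N → Module.Projective Abarᵐᵒᵖ N) ∧
    (∀ P : ModuleCat.{0} Abarᵐᵒᵖ, Module.Finite Abarᵐᵒᵖ P →
      Module.Projective Abarᵐᵒᵖ P →
      ∃ G : ModuleCat.{0} Aᵐᵒᵖ, Module.Finite Aᵐᵒᵖ G ∧ IsGProjMod A G ∧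
        RealizesTensor A ε G P) := by
  intro A ε Abar
  obtain ⟨rk, h⟩ := FRCycle.exists_isTriangular (t := t) honecycle
  refine ⟨fun N _ hN => ?_, fun P _ _ => ?_⟩
  · obtain ⟨P, d, -, hproj, hexact, -, ⟨iso⟩⟩ := hN
    obtain ⟨n, hn⟩ := h.exists_pdlt
    have := projective_range_of_exact n hn (fun n => P n) d hexact (-1)
    exact Module.Projective.of_equiv' iso.symm
  · have hA : IsArtinianRing Aᵐᵒᵖ := IsArtinianRing.of_finite k Aᵐᵒᵖ
    have hAbar : IsArtinianRing Abarᵐᵒᵖ :=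
      Function.Surjective.isArtinianRing (f := (qmap A ε).op)
        fun x => (qmap_surjective A ε x.unop).imp' op fun _ hy => congrArg op hy
    obtain ⟨G, _, _, hfin, hproj, q, hq, hsurj, hker⟩ :=
      h.liftsToProjective (vtxA_idem k Q Rel) (P := P)
    exact ⟨ModuleCat.of Aᵐᵒᵖ G, hfin, isGProjMod_of_projective G,
      RealizesTensor.of_map G P q hq hsurj hker⟩
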